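/- arXiv:1610.00900 — 5 statements merged into one kernel-verified Lean document; each statement's English description precedes it below -/
import Mathlib

section
/- Let C be a self-dual Z_2R linear code in Z_2^α × R^β. Then (C_b)_X is a binary self-dual code, i.e. (C_b)_X equals its own orthogonal complement in Z_2^α with respect to the standard dot product. -/
open Finset

namespace Z2R

abbrev Rng : Type := DualNumber (ZMod 2)
noncomputable instance : DecidableEq Rng := Classical.decEq _
def uu : Rng := DualNumber.eps
abbrev Amb (α β : ℕ) : Type := (Fin α → ZMod 2) × (Fin β → Rng)
def smulR {α β : ℕ} (d : Rng) (x : Amb α β) : Amb α β :=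
  (fun i => d.fst * x.1 i, fun j => d * x.2 j)
def IsCode {α β : ℕ} (C : Set (Amb α β)) : Prop :=
  (0 : Amb α β) ∈ C ∧ (∀ x ∈ C, ∀ y ∈ C, x + y ∈ C) ∧ ∀ (d : Rng), ∀ x ∈ C, smulR d x ∈ C
def inn {α β : ℕ} (v w : Amb α β) : Rng :=
  TrivSqZeroExt.inr (∑ i, v.1 i * w.1 i) + ∑ j, v.2 j * w.2 j
def dual {α β : ℕ} (C : Set (Amb α β)) : Set (Amb α β) :=
  {w | ∀ v ∈ C, inn v w = 0}
def IsSelfDual {α β : ℕ} (C : Set (Amb α β)) : Prop :=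
  IsCode C ∧ C = dual C
def wtH {n : ℕ} (v : Fin n → ZMod 2) : ℕ := (univ.filter fun i => v i ≠ 0).card
noncomputable def wtLr (r : Rng) : ℕ := if r = 0 then 0 else if r = uu then 2 else 1
noncomputable def wtL {α β : ℕ} (c : Amb α β) : ℕ := wtH c.1 + ∑ j, wtLr (c.2 j)
noncomputable def N {β : ℕ} (w : Fin β → Rng) : ℕ :=
  (univ.filter fun j => w j = 1 ∨ w j = 1 + uu).card
noncomputable def Nu {β : ℕ} (w : Fin β → Rng) : ℕ :=
  (univ.filter fun j => w j = uu).card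
noncomputable def Ns {β : ℕ} (w y : Fin β → Rng) : ℕ :=
  (univ.filter fun j => w j = y j ∧ (w j = 1 ∨ w j = 1 + uu)).card
noncomputable def Nd {β : ℕ} (w y : Fin β → Rng) : ℕ :=
  (univ.filter fun j => (w j = 1 ∧ y j = 1 + uu) ∨ (w j = 1 + uu ∧ y j = 1)).card
noncomputable def N11 {β : ℕ} (w y : Fin β → Rng) : ℕ :=
  (univ.filter fun j => (w j = 1 ∨ w j = 1 + uu) ∧ (y j = 1 ∨ y j = 1 + uu)).card
def CX {α β : ℕ} (C : Set (Amb α β)) : Set (Fin α → ZMod 2) := Prod.fst '' C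
def CY {α β : ℕ} (C : Set (Amb α β)) : Set (Fin β → Rng) := Prod.snd '' C
def Separable {α β : ℕ} (C : Set (Amb α β)) : Prop := C = (CX C) ×ˢ (CY C)
def Cb {α β : ℕ} (C : Set (Amb α β)) : Set (Amb α β) :=
  {c ∈ C | ∀ j, c.2 j = 0 ∨ c.2 j = uu}
def lincomb {α β k : ℕ} (g : Fin k → Amb α β) : Set (Amb α β) :=
  {z | ∃ a : Fin k → Rng, z = ∑ i, smulR (a i) (g i)}
noncomputable def theta (r : Rng) : ZMod 4 :=
  if r = 0 then 0 else if r = 1 then 1 else if r = uu then 2 else 3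

lemma zmod_two_eq_zero_or_one : ∀ a : ZMod 2, a = 0 ∨ a = 1 := by
  decide

/-- The subspace over `ZMod 2` underlying a code. -/
def codeSubmodule {α β : ℕ} (C : Set (Amb α β)) (hC : IsCode C) :
    Submodule (ZMod 2) (Amb α β) where
  carrier := C
  zero_mem' := hC.1
  add_mem' := fun hx hy => hC.2.1 _ hx _ hy
  smul_mem' := by
    intro c x hx
    rcases zmod_two_eq_zero_or_one c with rfl | rfl
    · simpa using hC.1
    · simpa using hx

lemma fst_eq_zero_iff (r : Rng) : r.fst = 0 ↔ r = 0 ∨ r = uu := by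
  constructor
  · intro h
    rcases zmod_two_eq_zero_or_one r.snd with h' | h'
    · exact Or.inl (TrivSqZeroExt.ext h h')
    · exact Or.inr (TrivSqZeroExt.ext h h')
  · rintro (rfl | rfl) <;> rfl

lemma fst_inn {α β : ℕ} (v w : Amb α β) :
    (inn v w).fst = ∑ j, (v.2 j).fst * (w.2 j).fst := by
  simp [inn, TrivSqZeroExt.fst_sum]

lemma snd_inn {α β : ℕ} (v w : Amb α β) :
    (inn v w).snd = ∑ i, v.1 i * w.1 i +
      ∑ j, ((v.2 j).fst * (w.2 j).snd + (v.2 j).snd * (w.2 j).fst) := by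
  simp [inn, TrivSqZeroExt.snd_sum]

/-- A functional on the binary coordinates vanishing on the codewords of `C` with residue-free
second block is, on `C`, a combination of the residues of the second block. -/
lemma exists_residue_coeffs {α β : ℕ} (C : Set (Amb α β)) (hC : IsCode C) (x : Fin α → ZMod 2)
    (hx : ∀ y ∈ Prod.fst '' Cb C, ∑ i, x i * y i = 0) :
    ∃ t : Fin β → ZMod 2, ∀ v ∈ C, ∑ j, t j * (v.2 j).fst = ∑ i, x i * v.1 i := by
  let S := codeSubmodule C hC
  let L : Fin β → S →ₗ[ZMod 2] ZMod 2 := fun j =>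
    { toFun := fun v => (v.1.2 j).fst
      map_add' := fun _ _ => rfl
      map_smul' := fun _ _ => rfl }
  let K : S →ₗ[ZMod 2] ZMod 2 :=
    { toFun := fun v => ∑ i, x i * v.1.1 i
      map_add' := fun a b => by simp [mul_add, Finset.sum_add_distrib]
      map_smul' := fun c a => by simp [Finset.mul_sum, mul_left_comm] }
  have hker : ⨅ j, LinearMap.ker (L j) ≤ LinearMap.ker K := by
    intro v hv
    simp only [Submodule.mem_iInf, LinearMap.mem_ker] at hv ⊢
    exact hx _ ⟨v.1, ⟨v.2, fun j => (fst_eq_zero_iff _).1 (hv j)⟩, rfl⟩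
  obtain ⟨t, ht⟩ :=
    (Submodule.mem_span_range_iff_exists_fun _).1 (mem_span_of_iInf_ker_le_ker hker)
  refine ⟨t, fun v hv => ?_⟩
  have h : (∑ j, t j • L j) ⟨v, hv⟩ = K ⟨v, hv⟩ := LinearMap.congr_fun ht ⟨v, hv⟩
  rw [LinearMap.sum_apply] at h
  exact h

-- STATEMENT 2
theorem stmt2 {α β : ℕ} (C : Set (Amb α β)) (hC : IsSelfDual C) :
    {x : Fin α → ZMod 2 | ∀ y ∈ Prod.fst '' Cb C, ∑ i, x i * y i = 0} = Prod.fst '' Cb C := by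
  obtain ⟨hcode, hdual⟩ := hC
  apply Set.Subset.antisymm
  · intro x hx
    obtain ⟨t, ht⟩ := exists_residue_coeffs C hcode x hx
    refine ⟨(x, fun j => TrivSqZeroExt.inr (t j)),
      ⟨?_, fun j => (fst_eq_zero_iff _).1 (TrivSqZeroExt.fst_inr _ _)⟩, rfl⟩
    rw [hdual]
    intro v hv
    refine TrivSqZeroExt.ext ?_ ?_
    · simp [fst_inn]
    · have h := ht v hv
      simp only [mul_comm (t _), mul_comm (x _)] at h
      simp [snd_inn, h, CharTwo.add_self_eq_zero]
  · rintro _ ⟨v, ⟨hv, hvb⟩, rfl⟩ _ ⟨w, ⟨hw, hwb⟩, rfl⟩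
    have hw' := hw
    rw [hdual] at hw'
    have h := congrArg TrivSqZeroExt.snd (hw' v hv)
    simpa [snd_inn, fun j => (fst_eq_zero_iff _).2 (hvb j),
      fun j => (fst_eq_zero_iff _).2 (hwb j)] using h

end Z2R
end

section
/- Let C be a self-dual Z_2R linear code in Z_2^α × R^β with α > 0, and let κ = dim_{Z_2}((C_b)_X). Then there exists an integer r with 1 ≤ r ≤ κ such that for every element y of C_Y the fiber {c ∈ C : the projection of c onto R^β equals y} has exactly 2^r elements; moreover |C_Y| ≥ 2^β. -/
open Finset

namespace Z2R

theorem snd_sum {ι : Type*} (s : Finset ι) (f : ι → Rng) :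
    (∑ j ∈ s, f j).snd = ∑ j ∈ s, (f j).snd :=
  map_sum (TrivSqZeroExt.sndHom (ZMod 2) (ZMod 2)) f s

theorem fst_sum {ι : Type*} (s : Finset ι) (f : ι → Rng) :
    (∑ j ∈ s, f j).fst = ∑ j ∈ s, (f j).fst :=
  map_sum (TrivSqZeroExt.fstHom (ZMod 2) (ZMod 2) (ZMod 2)) f s

/-- A code, regarded as a vector space over the two-element field. -/
def IsCode.toSubmodule {α β : ℕ} {C : Set (Amb α β)} (h : IsCode C) :
    Submodule (ZMod 2) (Amb α β) where
  carrier := C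
  zero_mem' := h.1
  add_mem' hx hy := h.2.1 _ hx _ hy
  smul_mem' c x hx := by
    have e : smulR (TrivSqZeroExt.inl c) x = c • x := by
      refine Prod.ext ?_ ?_
      · ext i
        simp [smulR]
      · ext j <;> simp [smulR]
    exact e ▸ h.2.2 (TrivSqZeroExt.inl c) x hx

theorem finrank_rng : Module.finrank (ZMod 2) Rng = 2 := by
  have : Module.finrank (ZMod 2) (ZMod 2 × ZMod 2) = 2 := by simp
  exact this

instance : Module.Finite (ZMod 2) Rng :=
  inferInstanceAs (Module.Finite (ZMod 2) (ZMod 2 × ZMod 2))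

/-- The `u`-coefficient of the standard inner product on `R^β`. -/
def sndForm (β : ℕ) : LinearMap.BilinForm (ZMod 2) (Fin β → Rng) :=
  LinearMap.mk₂ (ZMod 2) (fun y z => (∑ j, y j * z j).snd)
    (fun _ _ _ => by simp only [Pi.add_apply, add_mul, sum_add_distrib, TrivSqZeroExt.snd_add])
    (fun _ _ _ => by
      simp only [Pi.smul_apply, smul_mul_assoc, ← smul_sum, TrivSqZeroExt.snd_smul])
    (fun _ _ _ => by simp only [Pi.add_apply, mul_add, sum_add_distrib, TrivSqZeroExt.snd_add])
    (fun _ _ _ => by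
      simp only [Pi.smul_apply, mul_smul_comm, ← smul_sum, TrivSqZeroExt.snd_smul])

theorem sndForm_apply {β : ℕ} (y z : Fin β → Rng) : sndForm β y z = (∑ j, y j * z j).snd := rfl

theorem sndForm_isSymm (β : ℕ) : (sndForm β).IsSymm :=
  ⟨fun y z => by simp [sndForm_apply, mul_comm]⟩

theorem sndForm_nondegenerate (β : ℕ) : (sndForm β).Nondegenerate := by
  refine (LinearMap.IsRefl.nondegenerate_iff_separatingLeft (sndForm_isSymm β).isRefl).2
    fun y hy => ?_
  ext j
  · simpa [sndForm_apply, snd_sum, Pi.single_apply, apply_ite, mul_ite, uu]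
      using hy (Pi.single j uu)
  · simpa [sndForm_apply, snd_sum, Pi.single_apply, apply_ite, mul_ite]
      using hy (Pi.single j 1)

/-- In a self-dual code the fibre over zero contains the all-ones vector. -/
theorem IsSelfDual.ones_mem {α β : ℕ} {C : Set (Amb α β)} (hC : IsSelfDual C) :
    ((1, 0) : Amb α β) ∈ C := by
  have hsq : ∀ a : ZMod 2, a * a = a := by decide
  rw [hC.2]
  intro v hv
  have hvv : inn v v = 0 := (hC.2 ▸ hv : v ∈ dual C) v hv
  have h := congrArg TrivSqZeroExt.snd hvv
  simp only [inn, TrivSqZeroExt.snd_add, TrivSqZeroExt.snd_inr, snd_sum, hsq,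
    TrivSqZeroExt.snd_mul, TrivSqZeroExt.snd_zero, MulOpposite.smul_eq_mul_unop,
    smul_eq_mul, MulOpposite.unop_op, mul_comm, CharTwo.add_self_eq_zero, sum_const_zero,
    add_zero] at h
  simp [inn, h]

/-- The orthogonal space of the projection of a self-dual code onto `R^β` lies in that
projection. -/
theorem IsSelfDual.orthogonal_le {α β : ℕ} {C : Set (Amb α β)} (hC : IsSelfDual C) :
    (sndForm β).orthogonal (hC.1.toSubmodule.map (LinearMap.snd _ _ _)) ≤
      hC.1.toSubmodule.map (LinearMap.snd _ _ _) := by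
  intro y hy
  refine ⟨(0, y), ?_, rfl⟩
  change (0, y) ∈ C
  rw [hC.2]
  intro v hv
  have h1 : (∑ j, v.2 j * y j).snd = 0 := hy v.2 ⟨v, hv, rfl⟩
  have h2 : (∑ j, uu * v.2 j * y j).snd = 0 :=
    hy _ ⟨smulR uu v, hC.1.2.2 uu v hv, rfl⟩
  have h3 : (∑ j, v.2 j * y j).fst = 0 := by
    rw [← h2, fst_sum, snd_sum]
    simp [uu]
  have h4 : ∑ j, v.2 j * y j = 0 := TrivSqZeroExt.ext h3 h1
  simp [inn, h4]

theorem IsSelfDual.le_finrank {α β : ℕ} {C : Set (Amb α β)} (hC : IsSelfDual C) :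
    β ≤ Module.finrank (ZMod 2) (hC.1.toSubmodule.map (LinearMap.snd _ _ _)) := by
  have h := Submodule.finrank_mono hC.orthogonal_le
  rw [LinearMap.BilinForm.finrank_orthogonal (sndForm_nondegenerate β),
    Module.finrank_pi_fintype] at h
  simp only [finrank_rng, sum_const, card_univ, Fintype.card_fin, smul_eq_mul] at h
  omega

-- STATEMENT 3
theorem stmt3 {α β : ℕ} (hα : 0 < α) (C : Set (Amb α β)) (hC : IsSelfDual C) (κ : ℕ)
    (hκ : κ = Module.finrank (ZMod 2) (Submodule.span (ZMod 2) (Prod.fst '' Cb C))) :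
    (∃ r : ℕ, 1 ≤ r ∧ r ≤ κ ∧ ∀ y ∈ CY C, Nat.card {c ∈ C | c.2 = y} = 2 ^ r) ∧
      2 ^ β ≤ Nat.card (CY C) := by
  have hcard (V : Submodule (ZMod 2) (Fin α → ZMod 2)) :
      Nat.card V = 2 ^ Module.finrank (ZMod 2) V := by
    rw [Module.natCard_eq_pow_finrank (K := ZMod 2), Nat.card_zmod]
  let K : Submodule (ZMod 2) (Fin α → ZMod 2) :=
    hC.1.toSubmodule.comap (LinearMap.inl _ _ _)
  refine ⟨⟨Module.finrank (ZMod 2) K, ?_, ?_, ?_⟩, ?_⟩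
  · rw [Submodule.one_le_finrank_iff]
    intro hbot
    have h1 : (1 : Fin α → ZMod 2) ∈ K := hC.ones_mem
    rw [hbot, Submodule.mem_bot] at h1
    exact one_ne_zero (congrFun h1 ⟨0, hα⟩)
  · rw [hκ]
    exact Submodule.finrank_mono fun x hx =>
      Submodule.subset_span ⟨(x, 0), ⟨hx, fun _ => Or.inl rfl⟩, rfl⟩
  · rintro _ ⟨c, hc, rfl⟩
    rw [← hcard]
    refine Nat.card_congr
      { toFun := fun d => ⟨d.1.1 - c.1, ?_⟩
        invFun := fun x => ⟨(x.1 + c.1, c.2), ?_, rfl⟩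
        left_inv := ?_
        right_inv := ?_ }
    · obtain ⟨d, hd, hdc⟩ := d
      have h := hC.1.toSubmodule.sub_mem hd hc
      have e : d - c = (d.1 - c.1, 0) := Prod.ext rfl (sub_eq_zero.2 hdc)
      rwa [e] at h
    · have h := hC.1.2.1 _ x.2 _ hc
      have e : ((x.1, 0) : Amb α β) + c = (x.1 + c.1, c.2) := Prod.ext rfl (zero_add _)
      exact e ▸ h
    · rintro ⟨d, hd, hdc⟩
      exact Subtype.ext (Prod.ext (sub_add_cancel _ _) hdc.symm)
    · intro x
      exact Subtype.ext (add_sub_cancel_right _ _)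
  · have h : Nat.card (CY C) =
        2 ^ Module.finrank (ZMod 2) (hC.1.toSubmodule.map (LinearMap.snd _ _ _)) := by
      have e := Module.natCard_eq_pow_finrank (K := ZMod 2)
        (V := hC.1.toSubmodule.map (LinearMap.snd (ZMod 2) _ _))
      rwa [Nat.card_zmod] at e
    rw [h]
    exact Nat.pow_le_pow_right two_pos hC.le_finrank

end Z2R
end

section
/- Every codeword of a self-dual Z_2R linear code C in Z_2^α × R^β has even Lee weight. (Equivalently, there do not exist Z_2R linear self-dual codes of Type 0, i.e. self-dual codes possessing a codeword of odd Lee weight.) -/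
open Finset

namespace Z2R

theorem natCast_wtH {n : ℕ} (v : Fin n → ZMod 2) : (wtH v : ZMod 2) = ∑ i, v i := by
  have h : ∀ a : ZMod 2, (if a ≠ 0 then 1 else 0 : ZMod 2) = a := by decide
  simp only [wtH, Finset.card_filter, Nat.cast_sum, Nat.cast_ite, Nat.cast_one, Nat.cast_zero, h]

theorem natCast_wtLr (r : Rng) : (wtLr r : ZMod 2) = r.fst := by
  have h : ∀ a b : ZMod 2, ¬(a = 0 ∧ b = 0) → ¬(a = 0 ∧ b = 1) → 1 = a := by decide
  unfold wtLr
  split_ifs with h₀ h₁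
  · simp [h₀]
  · rw [h₁]
    exact (by decide : ((2 : ℕ) : ZMod 2) = 0)
  · rw [Nat.cast_one]
    exact h r.fst r.snd (fun e => h₀ (TrivSqZeroExt.ext e.1 e.2))
      (fun e => h₁ (TrivSqZeroExt.ext e.1 e.2))

theorem mul_self_eq_inl_fst (r : Rng) : r * r = TrivSqZeroExt.inl r.fst := by
  have h : ∀ a : ZMod 2, a * a = a := by decide
  ext
  · simp [h]
  · simp [CharTwo.add_self_eq_zero, mul_comm]

theorem inn_self {α β : ℕ} (c : Amb α β) :
    inn c c = TrivSqZeroExt.inr (∑ i, c.1 i) + TrivSqZeroExt.inl (∑ j, (c.2 j).fst) := by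
  have h : ∀ a : ZMod 2, a * a = a := by decide
  simp only [inn, h, mul_self_eq_inl_fst, TrivSqZeroExt.inl_sum]

-- STATEMENT 8
theorem stmt8 {α β : ℕ} (C : Set (Amb α β)) (hC : IsSelfDual C) :
    ∀ c ∈ C, Even (wtL c) := by
  intro c hc
  have hd : c ∈ dual C := hC.2 ▸ hc
  have h₀ : inn c c = 0 := hd c hc
  rw [inn_self] at h₀
  have hf : ∑ j, (c.2 j).fst = 0 := by simpa using congrArg TrivSqZeroExt.fst h₀
  have hs : ∑ i, c.1 i = 0 := by simpa using congrArg TrivSqZeroExt.snd h₀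
  rw [← ZMod.natCast_eq_zero_iff_even, wtL, Nat.cast_add, Nat.cast_sum, natCast_wtH, hs, zero_add]
  simpa only [natCast_wtLr] using hf

end Z2R
end

section
/- Let C be a self-orthogonal Z_2R linear code in Z_2^α × R^β such that for every pair of codewords (v | w), (x | y) ∈ C one has 4 | N_{1,1}(w, y). Then for every pair of codewords (v | w), (x | y) ∈ C, the Z_2Z_4 inner product of their images under θ vanishes: 2·Σ_{i=1}^α v_i x_i + Σ_{j=1}^β θ(w_j)θ(y_j) = 0 in Z_4 (where in the first sum v_i x_i ∈ Z_2 is lifted to {0,1} ⊆ Z_4). In particular, if C is self-dual, the image θ(C) is pairwise orthogonal with respect to the Z_2Z_4 inner product. -/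
open Finset

namespace Z2R

/-- The additive embedding `ZMod 2 → ZMod 4`, `x ↦ 2x`. -/
def double : ZMod 2 →+ ZMod 4 :=
  AddMonoidHom.mk' (fun x => 2 * (x.val : ZMod 4)) (by decide)

lemma double_apply (x : ZMod 2) : double x = 2 * (x.val : ZMod 4) := rfl

lemma theta_eq (r : Rng) : theta r = (r.fst.val : ZMod 4) + double r.snd := by
  have h0 : r = 0 ↔ r.fst = 0 ∧ r.snd = 0 := TrivSqZeroExt.ext_iff
  have h1 : r = 1 ↔ r.fst = 1 ∧ r.snd = 0 := TrivSqZeroExt.ext_iff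
  have hu : r = uu ↔ r.fst = 0 ∧ r.snd = 1 := TrivSqZeroExt.ext_iff
  simp only [theta, h0, h1, hu, double_apply]
  generalize r.fst = a
  generalize r.snd = b
  revert a b
  decide

lemma eq_one_or_eq_one_add_uu_iff (r : Rng) : (r = 1 ∨ r = 1 + uu) ↔ r.fst = 1 := by
  have h1 : r = 1 ↔ r.fst = 1 ∧ r.snd = 0 := TrivSqZeroExt.ext_iff
  have h2 : r = 1 + uu ↔ r.fst = 1 + 0 ∧ r.snd = 0 + 1 := TrivSqZeroExt.ext_iff
  rw [h1, h2]
  generalize r.fst = a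
  generalize r.snd = b
  revert a b
  decide

lemma theta_mul_theta (w y : Rng) :
    theta w * theta y =
      (if (w = 1 ∨ w = 1 + uu) ∧ (y = 1 ∨ y = 1 + uu) then 1 else 0) + double (w * y).snd := by
  simp only [theta_eq, eq_one_or_eq_one_add_uu_iff, DualNumber.snd_mul, double_apply]
  generalize w.fst = a
  generalize w.snd = b
  generalize y.fst = c
  generalize y.snd = d
  revert a b c d
  decide

lemma sum_theta_mul_theta {β : ℕ} (w y : Fin β → Rng) :
    ∑ j, theta (w j) * theta (y j) = (N11 w y : ZMod 4) + double (∑ j, w j * y j).snd := by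
  simp only [theta_mul_theta, sum_add_distrib, N11, TrivSqZeroExt.snd_sum, map_sum,
    natCast_card_filter]

-- STATEMENT 13
theorem stmt13 {α β : ℕ} (C : Set (Amb α β)) (hcode : IsCode C) (hso : C ⊆ dual C)
    (hN : ∀ c ∈ C, ∀ d ∈ C, (4 : ℕ) ∣ N11 c.2 d.2) :
    ∀ c ∈ C, ∀ d ∈ C,
      2 * (∑ i, (((c.1 i * d.1 i : ZMod 2).val : ZMod 4))) +
        ∑ j, theta (c.2 j) * theta (d.2 j) = 0 := by
  intro c hc d hd
  have hinn : inn c d = 0 := hso hd c hc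
  have hsnd : ∑ i, c.1 i * d.1 i + (∑ j, c.2 j * d.2 j).snd = 0 :=
    congrArg TrivSqZeroExt.snd hinn
  have hcard : (N11 c.2 d.2 : ZMod 4) = 0 := (ZMod.natCast_eq_zero_iff _ 4).2 (hN c hc d hd)
  have hbin : 2 * (∑ i, (((c.1 i * d.1 i : ZMod 2).val : ZMod 4))) =
      double (∑ i, c.1 i * d.1 i) := by
    simp only [mul_sum, map_sum, double_apply]
  rw [sum_theta_mul_theta, hcard, zero_add, hbin, ← map_add, hsnd, map_zero]

end Z2R
end

section
/- Let C ⊆ Z_2^α × R^β be a Z_2R linear code with α > 0 and β > 0 such that (1,…,1 | 0,…,0) ∈ C and (0,…,0 | u,…,u) ∈ C, the set of Lee weights of nonzero codewords of C has exactly two elements, and α = 2β; write n = α + 2β. Let C* = {(0,…,0 | 0,…,0), (1,…,1 | 0,…,0), (0,…,0 | u,…,u), (1,…,1 | u,…,u)}. Then for every codeword (v | w) ∈ C \ C*, one has wt_H(v) = n/4 and either N(w) = n/4 and N_u(w) = 0, or N(w) = 0 and N_u(w) = n/8. -/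
open Finset

namespace Z2R

theorem zmod_two_cases (x : ZMod 2) : x = 0 ∨ x = 1 := by
  revert x; decide

theorem fst_uu : uu.fst = 0 := rfl

theorem snd_uu : uu.snd = 1 := rfl

theorem rng_cases (r : Rng) : r = 0 ∨ r = 1 ∨ r = uu ∨ r = 1 + uu := by
  rcases zmod_two_cases r.fst with h | h <;> rcases zmod_two_cases r.snd with h' | h' <;>
    simp [TrivSqZeroExt.ext_iff, fst_uu, snd_uu, h, h']

theorem uu_ne_zero : uu ≠ 0 := by simp [TrivSqZeroExt.ext_iff, fst_uu, snd_uu]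

theorem one_ne_uu : (1 : Rng) ≠ uu := by simp [TrivSqZeroExt.ext_iff, fst_uu, snd_uu]

theorem one_add_uu_ne_zero : 1 + uu ≠ 0 := by
  simp [TrivSqZeroExt.ext_iff, fst_uu, snd_uu]

theorem one_add_uu_ne_uu : 1 + uu ≠ uu := by simp

theorem uu_mul_uu : uu * uu = 0 := DualNumber.eps_mul_eps

theorem wtL_eq {α β : ℕ} (c : Amb α β) : wtL c = wtH c.1 + (N c.2 + 2 * Nu c.2) := by
  simp only [wtL, N, Nu, card_filter, mul_sum, ← sum_add_distrib]
  congr 1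
  refine sum_congr rfl fun j _ => ?_
  rcases rng_cases (c.2 j) with h | h | h | h <;>
    simp [h, wtLr, uu_ne_zero, uu_ne_zero.symm, one_ne_uu, one_ne_uu.symm, one_add_uu_ne_zero,
      one_add_uu_ne_zero.symm, one_add_uu_ne_uu.symm]

theorem N_add_Nu_le {β : ℕ} (w : Fin β → Rng) : N w + Nu w ≤ β := by
  have hd : Disjoint (univ.filter fun j => w j = 1 ∨ w j = 1 + uu)
      (univ.filter fun j => w j = uu) := by
    refine disjoint_filter.2 fun j _ h h' => ?_
    rw [h'] at h
    exact h.elim one_ne_uu.symm one_add_uu_ne_uu.symm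
  rw [N, Nu, ← card_union_of_disjoint hd]
  exact (card_le_univ _).trans_eq (Fintype.card_fin β)

theorem wtH_le {n : ℕ} (v : Fin n → ZMod 2) : wtH v ≤ n :=
  (card_le_univ _).trans_eq (Fintype.card_fin n)

theorem wtH_zero {n : ℕ} : wtH (0 : Fin n → ZMod 2) = 0 := by simp [wtH]

theorem wtH_add_one {n : ℕ} (v : Fin n → ZMod 2) : wtH (v + fun _ => 1) + wtH v = n := by
  have h : ∀ x : ZMod 2, x + 1 ≠ 0 ↔ ¬ x ≠ 0 := by decide
  simp only [wtH, Pi.add_apply, h]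
  rw [add_comm, card_filter_add_card_filter_not, card_univ, Fintype.card_fin]

theorem eq_zero_of_wtH_eq_zero {n : ℕ} {v : Fin n → ZMod 2} (h : wtH v = 0) :
    v = fun _ => 0 := by
  ext1 i
  simpa using filter_eq_empty_iff.1 (card_eq_zero.1 h) (mem_univ i)

theorem eq_one_of_wtH_eq {n : ℕ} {v : Fin n → ZMod 2} (h : wtH v = n) : v = fun _ => 1 := by
  ext1 i
  have hi := filter_eq_self.1 (eq_univ_of_card _ (h.trans (Fintype.card_fin n).symm)) i
    (mem_univ i)
  exact (zmod_two_cases (v i)).resolve_left hi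

theorem eq_uu_of_Nu_eq {β : ℕ} {w : Fin β → Rng} (h : Nu w = β) : w = fun _ => uu := by
  ext1 j
  exact filter_eq_self.1 (eq_univ_of_card _ (h.trans (Fintype.card_fin β).symm)) j (mem_univ j)

theorem wtL_smulR_uu {α β : ℕ} (c : Amb α β) : wtL (smulR uu c) = 2 * N c.2 := by
  have hv : (smulR uu c).1 = 0 := by
    ext1 i
    simp [smulR, fst_uu]
  have hw (j : Fin β) : wtLr (uu * c.2 j) = 2 * if c.2 j = 1 ∨ c.2 j = 1 + uu then 1 else 0 := by
    rcases rng_cases (c.2 j) with h | h | h | h <;>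
      simp [h, wtLr, mul_add, uu_mul_uu, uu_ne_zero, one_ne_uu.symm, one_add_uu_ne_zero.symm,
        one_add_uu_ne_uu.symm]
  rw [wtL, hv, wtH_zero, zero_add, N, card_filter, mul_sum]
  exact sum_congr rfl fun j _ => hw j

theorem wtL_ones {α β : ℕ} : wtL ((fun _ => 1, fun _ => 0) : Amb α β) = α := by
  simp [wtL, wtH, wtLr]

theorem wtL_ones_uu {α β : ℕ} : wtL ((fun _ => 1, fun _ => uu) : Amb α β) = α + 2 * β := by
  simp [wtL, wtH, wtLr, uu_ne_zero, mul_comm]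

theorem wtL_zero {α β : ℕ} : wtL (0 : Amb α β) = 0 := by simp [wtL, wtH, wtLr]

theorem ne_zero_of_wtL_pos {α β : ℕ} {c : Amb α β} (h : 0 < wtL c) : c ≠ 0 := by
  rintro rfl
  simp [wtL_zero] at h

-- STATEMENT 17
theorem stmt17 {α β : ℕ} (hα : 0 < α) (hβ : 0 < β) (C : Set (Amb α β)) (hcode : IsCode C)
    (h1 : ((fun _ => 1, fun _ => 0) : Amb α β) ∈ C)
    (h2 : ((fun _ => 0, fun _ => uu) : Amb α β) ∈ C)
    (htw : (wtL '' (C \ {0})).ncard = 2) (hab : α = 2 * β) :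
    ∀ c ∈ C,
      c ∉ ({0, (fun _ => 1, fun _ => 0), (fun _ => 0, fun _ => uu),
              (fun _ => 1, fun _ => uu)} : Set (Amb α β)) →
      4 * wtH c.1 = α + 2 * β ∧
        ((4 * N c.2 = α + 2 * β ∧ Nu c.2 = 0) ∨
          (N c.2 = 0 ∧ 8 * Nu c.2 = α + 2 * β)) := by
  obtain ⟨_, hadd, hsmul⟩ := hcode
  have h3 : ((fun _ => 1, fun _ => uu) : Amb α β) ∈ C := by
    convert hadd _ h1 _ h2 using 1
    ext <;> simp
  obtain ⟨x, y, -, hxy⟩ := Set.ncard_eq_two.1 htw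
  have hmem : ∀ c ∈ C, c ≠ 0 → wtL c = x ∨ wtL c = y := fun c hc h0 => by
    have h : wtL c ∈ wtL '' (C \ {0}) := ⟨c, ⟨hc, h0⟩, rfl⟩
    rwa [hxy] at h
  have hwt : ∀ c ∈ C, c ≠ 0 → wtL c = 2 * β ∨ wtL c = 4 * β := fun c hc h0 => by
    have hx := hmem _ h1 (ne_zero_of_wtL_pos (wtL_ones.symm ▸ hα))
    have hy := hmem _ h3 (ne_zero_of_wtL_pos (by rw [wtL_ones_uu]; omega))
    rw [wtL_ones] at hx
    rw [wtL_ones_uu] at hy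
    have := hmem c hc h0
    omega
  intro c hc hne
  simp only [Set.mem_insert_iff, Set.mem_singleton_iff, not_or] at hne
  obtain ⟨hc0, hc1, hc2, hc3⟩ := hne
  have hle := N_add_Nu_le c.2
  have hle' := wtH_le c.1
  have hsum := wtH_add_one c.1
  have hfull : ¬ (wtH c.1 = α ∧ Nu c.2 = β) := fun h =>
    hc3 (Prod.ext (eq_one_of_wtH_eq h.1) (eq_uu_of_Nu_eq h.2))
  have huu : ¬ (wtH c.1 = 0 ∧ Nu c.2 = β) := fun h =>
    hc2 (Prod.ext (eq_zero_of_wtH_eq_zero h.1) (eq_uu_of_Nu_eq h.2))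
  have hwc := hwt c hc hc0
  have hshift : c + ((fun _ => 1, fun _ => 0) : Amb α β) ≠ 0 := fun h => by
    refine hc1 (Prod.ext (funext fun i => ?_) (funext fun j => ?_))
    · have hi : c.1 i + 1 = 0 := congrFun (congrArg Prod.fst h) i
      exact (zmod_two_cases (c.1 i)).resolve_left fun h' => by simp [h'] at hi
    · have hj : c.2 j + 0 = 0 := congrFun (congrArg Prod.snd h) j
      simpa using hj
  have hws := hwt _ (hadd c hc _ h1) hshift
  have hsnd : (c + ((fun _ => 1, fun _ => 0) : Amb α β)).2 = c.2 := add_zero c.2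
  rw [wtL_eq, hsnd, Prod.fst_add] at hws
  rw [wtL_eq] at hwc
  have hN : N c.2 = 0 ∨ N c.2 = β := by
    have hu := wtL_smulR_uu c
    by_cases h : smulR uu c = 0
    · rw [h, wtL_zero] at hu
      omega
    · have := hwt _ (hsmul uu c hc) h
      omega
  dsimp only at hws
  omega

end Z2R
end
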